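/- Let s₂(n) denote the sum of the binary digits of the natural number n, let j := exp(2πi/3) ∈ ℂ, and define w : ℕ → ℂ by w(n) := (-1)^{s₂(n)} · (j²)^n. Then for every natural number n: w(4n) = w(n), w(4n+1) = -j²·w(n), w(4n+2) = -j·w(n), and w(4n+3) = w(n). (This expresses that Dekking's 4-uniform morphism on {1, -j, -j², -1, j, j²} given by z ↦ z, -j²z, -jz, z has as its fixed point beginning in 1 the sequence obtained from the sequence ((-1)^{s₂(n)} j^n) by interchanging j and j².) -/

import Mathlib

/-- Sum of the binary digits of `n`. -/
def s2 (n : ℕ) : ℕ := (Nat.digits 2 n).sum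

/-- The primitive cube root of unity `j = exp(2πi/3)`. -/
noncomputable def jc : ℂ := Complex.exp (2 * Real.pi * Complex.I / 3)

/-- The sequence `w n = (-1)^{s₂(n)} (j²)^n`. -/
noncomputable def w (n : ℕ) : ℂ := (-1) ^ s2 n * (jc ^ 2) ^ n

theorem jc_cube : jc ^ 3 = 1 := by
  unfold jc
  rw [← Complex.exp_nat_mul, ← Complex.exp_two_pi_mul_I]
  congr 1
  push_cast
  ring

theorem s2_even (n : ℕ) : s2 (2 * n) = s2 n := by
  unfold s2
  rcases Nat.eq_zero_or_pos n with rfl | h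
  · simp
  · rw [Nat.digits_def' (by norm_num) (by omega)]
    simp

theorem s2_odd (n : ℕ) : s2 (2 * n + 1) = s2 n + 1 := by
  unfold s2
  rw [Nat.digits_def' (by norm_num) (by omega)]
  have h1 : (2 * n + 1) % 2 = 1 := by omega
  have h2 : (2 * n + 1) / 2 = n := by omega
  rw [h1, h2, List.sum_cons, add_comm]

theorem jpow (n : ℕ) : (jc ^ 2) ^ (4 * n) = (jc ^ 2) ^ n := by
  have : (jc ^ 2) ^ (4 * n) = (jc ^ 3) ^ (2 * n) * (jc ^ 2) ^ n := by ring
  rw [this, jc_cube, one_pow, one_mul]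

theorem stmt_4 (n : ℕ) :
    w (4 * n) = w n ∧ w (4 * n + 1) = -jc ^ 2 * w n ∧
    w (4 * n + 2) = -jc * w n ∧ w (4 * n + 3) = w n := by
  have e0 : s2 (4 * n) = s2 n := by
    rw [show 4 * n = 2 * (2 * n) by ring, s2_even, s2_even]
  have e1 : s2 (4 * n + 1) = s2 n + 1 := by
    rw [show 4 * n + 1 = 2 * (2 * n) + 1 by ring, s2_odd, s2_even]
  have e2 : s2 (4 * n + 2) = s2 n + 1 := by
    rw [show 4 * n + 2 = 2 * (2 * n + 1) by ring, s2_even, s2_odd]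
  have e3 : s2 (4 * n + 3) = s2 n + 2 := by
    rw [show 4 * n + 3 = 2 * (2 * n + 1) + 1 by ring, s2_odd, s2_odd]
  have h := jc_cube
  unfold w
  rw [e0, e1, e2, e3, pow_add (jc ^ 2) (4 * n) 1, pow_add (jc ^ 2) (4 * n) 2,
    pow_add (jc ^ 2) (4 * n) 3, jpow]
  generalize (jc ^ 2) ^ n = x
  rw [pow_add (-1 : ℂ) _ 1, pow_add (-1 : ℂ) _ 2]
  generalize (-1 : ℂ) ^ s2 n = y
  refine ⟨rfl, by ring, ?_, ?_⟩
  · linear_combination (-y * x * jc) * h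
  · linear_combination (y * x * (jc ^ 3 + 1)) * h
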